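/- Let q ∈ ℂ with 0 < |q| < 1. Then Ramanujan's second-order mock theta function B(q) := Σ_{n=0}^{∞} q^n (−q;q²)_n / (q;q²)_{n+1} satisfies B(q) = (1/θ_{q⁴}(−q⁶)) Σ_{n∈ℤ} ((1 + q^{4n+3})/(1 − q^{4n+3})) q^{8n² + 12n + 2}, where both the unilateral and the bilateral series converge absolutely. -/

import Mathlib

noncomputable section

/-- Infinite q-Pochhammer symbol `(a;p)_∞`. -/
def qpinf (a p : ℂ) : ℂ := ∏' j : ℕ, (1 - a * p ^ j)

/-- Finite q-Pochhammer symbol `(a;p)_n`, `n : ℕ`. -/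
def qpn (a p : ℂ) (n : ℕ) : ℂ := ∏ j ∈ Finset.range n, (1 - a * p ^ j)

/-- Theta function with base `p`: `θ_p(x) = (p;p)_∞ (-x;p)_∞ (-p/x;p)_∞`. -/
def thetaP (p x : ℂ) : ℂ := qpinf p p * qpinf (-x) p * qpinf (-p / x) p

open Filter Topology Finset

lemma one_sub_ne_zero_of_norm_lt_one {x : ℂ} (hx : ‖x‖ < 1) : 1 - x ≠ 0 := by
  intro h
  rw [← sub_eq_zero.mp h] at hx
  simp at hx

lemma one_sub_pow_succ_ne_zero {q : ℂ} (hq : ‖q‖ < 1) (m : ℕ) : 1 - q ^ (m + 1) ≠ 0 :=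
  one_sub_ne_zero_of_norm_lt_one (by
    rw [norm_pow]; exact pow_lt_one₀ (norm_nonneg _) hq m.succ_ne_zero)

lemma one_sub_mul_pow_ne_zero {a p : ℂ} (ha : ‖a‖ < 1) (hp : ‖p‖ < 1) (j : ℕ) :
    1 - a * p ^ j ≠ 0 :=
  one_sub_ne_zero_of_norm_lt_one (by
    rw [norm_mul, norm_pow]
    exact mul_lt_one_of_nonneg_of_lt_one_left (norm_nonneg _) ha
      (pow_le_one₀ (norm_nonneg _) hp.le))

lemma qpn_zero (a p : ℂ) : qpn a p 0 = 1 := by simp [qpn]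

lemma qpn_succ (a p : ℂ) (n : ℕ) : qpn a p (n + 1) = qpn a p n * (1 - a * p ^ n) := by
  simp [qpn, prod_range_succ]

lemma qpn_ne_zero {a p : ℂ} (ha : ‖a‖ < 1) (hp : ‖p‖ < 1) (n : ℕ) : qpn a p n ≠ 0 :=
  prod_ne_zero_iff.mpr fun j _ => one_sub_mul_pow_ne_zero ha hp j

lemma summable_norm_neg_mul_pow (a : ℂ) {p : ℂ} (hp : ‖p‖ < 1) :
    Summable fun j : ℕ => ‖-(a * p ^ j)‖ := by
  simpa using (summable_geometric_of_lt_one (norm_nonneg p) hp).mul_left ‖a‖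

lemma multipliable_one_sub_mul_pow (a : ℂ) {p : ℂ} (hp : ‖p‖ < 1) :
    Multipliable fun j : ℕ => 1 - a * p ^ j := by
  simpa [sub_eq_add_neg] using multipliable_one_add_of_summable (summable_norm_neg_mul_pow a hp)

lemma tendsto_qpn (a : ℂ) {p : ℂ} (hp : ‖p‖ < 1) :
    Tendsto (qpn a p) atTop (𝓝 (qpinf a p)) :=
  (multipliable_one_sub_mul_pow a hp).tendsto_prod_tprod_nat

lemma qpinf_ne_zero {a p : ℂ} (ha : ‖a‖ < 1) (hp : ‖p‖ < 1) : qpinf a p ≠ 0 := by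
  have := tprod_one_add_ne_zero_of_summable (f := fun j : ℕ => -(a * p ^ j))
    (fun j => by simpa [sub_eq_add_neg] using one_sub_mul_pow_ne_zero ha hp j)
    (summable_norm_neg_mul_pow a hp)
  simpa [qpinf, sub_eq_add_neg] using this

lemma exists_norm_le_of_tendsto {u : ℕ → ℂ} {l : ℂ} (h : Tendsto u atTop (𝓝 l)) :
    ∃ C : ℝ, ∀ n, ‖u n‖ ≤ C := by
  obtain ⟨C, hC⟩ := h.norm.bddAbove_range
  exact ⟨C, fun n => hC ⟨n, rfl⟩⟩

/-- A common bound for the products `(a;p)_n` and their inverses. -/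
lemma exists_norm_qpn_le {a p : ℂ} (ha : ‖a‖ < 1) (hp : ‖p‖ < 1) :
    ∃ C : ℝ, 0 < C ∧ ∀ n, ‖qpn a p n‖ ≤ C ∧ ‖(qpn a p n)⁻¹‖ ≤ C := by
  obtain ⟨C, hC⟩ := exists_norm_le_of_tendsto (tendsto_qpn a hp)
  obtain ⟨D, hD⟩ := exists_norm_le_of_tendsto ((tendsto_qpn a hp).inv₀ (qpinf_ne_zero ha hp))
  refine ⟨max 1 (max C D), by positivity, fun n => ⟨?_, ?_⟩⟩
  · exact (hC n).trans ((le_max_left _ _).trans (le_max_right _ _))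
  · exact (hD n).trans ((le_max_right _ _).trans (le_max_right _ _))

/-- Summand over `k ≥ 0` of the Appell-type series for `B(q)`, without the second Gaussian. -/
def appellCoeff (q : ℂ) (k : ℕ) : ℂ :=
  (-1) ^ k * q ^ (k * (k + 1)) * ((1 + q ^ (2 * k + 1)) / (1 - q ^ (2 * k + 1)))

/-- Telescoping certificate for the partial fraction expansion of `1 / (q;q²)_{n+1}²`. -/
def pfCert (q : ℂ) (n k : ℕ) : ℂ :=
  -(q ^ (2 * (n + 1 - k)) * (1 - q ^ (2 * k)) / (1 - q ^ (2 * n + 2))) *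
    qpn q (q ^ 2) (n + 1) ^ 2 * ((-1) ^ k * q ^ (k * (k + 1))) /
      (qpn (q ^ 2) (q ^ 2) (n + 1 - k) * qpn (q ^ 2) (q ^ 2) (n + k + 1))

/-- Summand of the partial fraction expansion of `1 / (q;q²)_{n+1}²`. -/
def pfTerm (q : ℂ) (n k : ℕ) : ℂ :=
  qpn q (q ^ 2) (n + 1) ^ 2 * appellCoeff q k /
    (qpn (q ^ 2) (q ^ 2) (n - k) * qpn (q ^ 2) (q ^ 2) (n + k + 1))

lemma norm_sq_lt_one {q : ℂ} (hq : ‖q‖ < 1) : ‖q ^ 2‖ < 1 := by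
  rw [norm_pow]; exact pow_lt_one₀ (norm_nonneg _) hq two_ne_zero

lemma pfTerm_succ_sub {q : ℂ} (hq : ‖q‖ < 1) {n k : ℕ} (hk : k ≤ n) :
    pfTerm q (n + 1) k - pfTerm q n k = pfCert q n (k + 1) - pfCert q n k := by
  obtain ⟨i, rfl⟩ := Nat.exists_eq_add_of_le hk
  have hp := norm_sq_lt_one hq
  have e1 : k + i + 1 - k = i + 1 := by omega
  have e2 : k + i - k = i := by omega
  have e3 : k + i + 1 - (k + 1) = i := by omega
  have e4 : k + i + 1 + k + 1 = k + i + k + 1 + 1 := by omega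
  have e5 : k + i + (k + 1) + 1 = k + i + k + 1 + 1 := by omega
  simp only [pfTerm, pfCert, appellCoeff, e1, e2, e3, e4, e5]
  have hA := qpn_ne_zero hp hp i
  have hD := qpn_ne_zero hp hp (k + i + k + 1)
  have h1 := one_sub_pow_succ_ne_zero hq (2 * i + 1)
  have h2 := one_sub_pow_succ_ne_zero hq (4 * k + 2 * i + 3)
  have h3 := one_sub_pow_succ_ne_zero hq (2 * k + 2 * i + 1)
  have h4 := one_sub_pow_succ_ne_zero hq (2 * k)
  rw [qpn_succ _ _ (k + i + 1), qpn_succ _ _ (k + i + k + 1), qpn_succ _ _ i]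
  generalize qpn (q ^ 2) (q ^ 2) i = A at *
  generalize qpn (q ^ 2) (q ^ 2) (k + i + k + 1) = D at *
  generalize qpn q (q ^ 2) (k + i + 1) = S at *
  have f1 : q ^ 2 * (q ^ 2) ^ i = q ^ 2 * q ^ (2 * i) := by ring
  have f2 : q ^ 2 * (q ^ 2) ^ (k + i + k + 1) = q ^ 4 * (q ^ (2 * k)) ^ 2 * q ^ (2 * i) := by ring
  have f3 : q * (q ^ 2) ^ (k + i + 1) = q ^ 3 * q ^ (2 * k) * q ^ (2 * i) := by ring
  have f4 : q ^ (2 * (k + i) + 2) = q ^ 2 * q ^ (2 * k) * q ^ (2 * i) := by ring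
  have f5 : q ^ (2 * k + 1) = q * q ^ (2 * k) := by ring
  have f6 : q ^ (2 * (k + 1)) = q ^ 2 * q ^ (2 * k) := by ring
  have f7 : q ^ (2 * (i + 1)) = q ^ 2 * q ^ (2 * i) := by ring
  have f8 : q ^ ((k + 1) * (k + 1 + 1)) = q ^ (k * (k + 1)) * q ^ 2 * q ^ (2 * k) := by ring
  have g1 : q ^ (2 * i + 1 + 1) = q ^ 2 * q ^ (2 * i) := by ring
  have g2 : q ^ (4 * k + 2 * i + 3 + 1) = q ^ 4 * (q ^ (2 * k)) ^ 2 * q ^ (2 * i) := by ring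
  have g3 : q ^ (2 * k + 2 * i + 1 + 1) = q ^ 2 * q ^ (2 * k) * q ^ (2 * i) := by ring
  rw [g1] at h1
  rw [g2] at h2
  rw [g3] at h3
  rw [f5] at h4
  rw [f1, f2, f3, f4, f5, f6, f7, f8, pow_succ (-1 : ℂ) k]
  generalize q ^ (2 * k) = y at *
  generalize q ^ (2 * i) = z at *
  generalize q ^ (k * (k + 1)) = e at *
  generalize (-1 : ℂ) ^ k = s at *
  field_simp
  ring

lemma pfTerm_self_eq_neg_pfCert {q : ℂ} (hq : ‖q‖ < 1) (n : ℕ) :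
    pfTerm q (n + 1) (n + 1) = - pfCert q n (n + 1) := by
  have hp := norm_sq_lt_one hq
  have e4 : n + 1 + (n + 1) + 1 = n + (n + 1) + 1 + 1 := by omega
  simp only [pfTerm, pfCert, appellCoeff, Nat.sub_self, e4, qpn_zero]
  have hD := qpn_ne_zero hp hp (n + (n + 1) + 1)
  have h2 := one_sub_pow_succ_ne_zero hq (4 * n + 5)
  have h3 := one_sub_pow_succ_ne_zero hq (2 * n + 1)
  have h4 := one_sub_pow_succ_ne_zero hq (2 * n + 2)
  rw [qpn_succ _ _ (n + 1), qpn_succ _ _ (n + (n + 1) + 1)]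
  generalize qpn (q ^ 2) (q ^ 2) (n + (n + 1) + 1) = D at *
  generalize qpn q (q ^ 2) (n + 1) = S at *
  have f2 : q ^ 2 * (q ^ 2) ^ (n + (n + 1) + 1) = q ^ 6 * (q ^ (2 * n)) ^ 2 := by ring
  have f3 : q * (q ^ 2) ^ (n + 1) = q ^ 3 * q ^ (2 * n) := by ring
  have f4 : q ^ (2 * n + 2) = q ^ 2 * q ^ (2 * n) := by ring
  have f5 : q ^ (2 * (n + 1) + 1) = q ^ 3 * q ^ (2 * n) := by ring
  have f6 : q ^ (2 * (n + 1)) = q ^ 2 * q ^ (2 * n) := by ring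
  have g2 : q ^ (4 * n + 5 + 1) = q ^ 6 * (q ^ (2 * n)) ^ 2 := by ring
  have g3 : q ^ (2 * n + 1 + 1) = q ^ 2 * q ^ (2 * n) := by ring
  have g4 : q ^ (2 * n + 2 + 1) = q ^ 3 * q ^ (2 * n) := by ring
  rw [g2] at h2
  rw [g3] at h3
  rw [g4] at h4
  rw [f2, f3, f4, f5, f6]
  generalize q ^ (2 * n) = y at *
  generalize q ^ ((n + 1) * (n + 1 + 1)) = e at *
  generalize (-1 : ℂ) ^ (n + 1) = s at *
  field_simp
  ring

lemma sum_pfTerm {q : ℂ} (hq : ‖q‖ < 1) (n : ℕ) :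
    ∑ k ∈ range (n + 1), pfTerm q n k = 1 := by
  induction n with
  | zero =>
    have h := one_sub_ne_zero_of_norm_lt_one hq
    have h2 := one_sub_ne_zero_of_norm_lt_one (norm_sq_lt_one hq)
    simp [pfTerm, appellCoeff, qpn]
    field_simp
    ring
  | succ n ih =>
    have h : ∑ k ∈ range (n + 1), (pfTerm q (n + 1) k - pfTerm q n k)
        = pfCert q n (n + 1) - pfCert q n 0 := by
      rw [← sum_range_sub]
      exact sum_congr rfl fun k hk =>
        pfTerm_succ_sub hq (Nat.lt_succ_iff.mp (mem_range.mp hk))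
    have h0 : pfCert q n 0 = 0 := by simp [pfCert]
    rw [sum_sub_distrib, ih, h0, sub_zero] at h
    rw [sum_range_succ, pfTerm_self_eq_neg_pfCert hq]
    linear_combination h

/-- Partial fraction expansion of `1 / (q;q²)_{n+1}²`. -/
lemma inv_qpn_sq_eq_sum {q : ℂ} (hq : ‖q‖ < 1) (n : ℕ) :
    (qpn q (q ^ 2) (n + 1) ^ 2)⁻¹ = ∑ k ∈ range (n + 1),
      appellCoeff q k / (qpn (q ^ 2) (q ^ 2) (n - k) * qpn (q ^ 2) (q ^ 2) (n + k + 1)) := by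
  have hS := qpn_ne_zero hq (norm_sq_lt_one hq) (n + 1)
  have h := sum_pfTerm hq n
  simp only [pfTerm, mul_div_assoc, ← mul_sum] at h
  exact inv_eq_of_mul_eq_one_right h

/-- Summand of the `q`-Gauss type series arising after exchanging the summations. -/
def gaussTerm (q : ℂ) (k m : ℕ) : ℂ :=
  qpn (-q ^ 2) (q ^ 2) (k + m) * q ^ (2 * m * k + m * (m + 1)) /
    (qpn (q ^ 2) (q ^ 2) m * qpn (q ^ 2) (q ^ 2) (m + 2 * k + 1))

/-- Telescoping certificate showing that `∑ m, gaussTerm q k m` does not depend on `k`. -/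
def gaussCert (q : ℂ) (k m : ℕ) : ℂ :=
  (1 + q ^ (2 * k + 2) * (1 - q ^ (2 * k + 2)) * q ^ (2 * m)) * (1 - q ^ (2 * m)) /
    (1 - q ^ (2 * m + 4 * k + 4)) * gaussTerm q k m

lemma gaussTerm_succ_sub {q : ℂ} (hq : ‖q‖ < 1) (k m : ℕ) :
    gaussTerm q (k + 1) m - gaussTerm q k m = gaussCert q k (m + 1) - gaussCert q k m := by
  have hp := norm_sq_lt_one hq
  have e1 : k + 1 + m = k + m + 1 := by omega
  have e2 : k + (m + 1) = k + m + 1 := by omega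
  have e3 : m + 2 * (k + 1) + 1 = m + 2 * k + 1 + 1 + 1 := by omega
  have e4 : m + 1 + 2 * k + 1 = m + 2 * k + 1 + 1 := by omega
  simp only [gaussTerm, gaussCert, e1, e2, e3, e4]
  have hA := qpn_ne_zero hp hp m
  have hD := qpn_ne_zero hp hp (m + 2 * k + 1)
  have h1 := one_sub_pow_succ_ne_zero hq (2 * m + 1)
  have h2 := one_sub_pow_succ_ne_zero hq (2 * m + 4 * k + 3)
  have h3 := one_sub_pow_succ_ne_zero hq (2 * m + 4 * k + 5)
  rw [qpn_succ _ _ (k + m), qpn_succ _ _ (m + 2 * k + 1 + 1), qpn_succ _ _ (m + 2 * k + 1),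
    qpn_succ _ _ m]
  generalize qpn (q ^ 2) (q ^ 2) m = A at *
  generalize qpn (q ^ 2) (q ^ 2) (m + 2 * k + 1) = D at *
  generalize qpn (-q ^ 2) (q ^ 2) (k + m) = S at *
  have f1 : q ^ 2 * (q ^ 2) ^ m = q ^ 2 * q ^ (2 * m) := by ring
  have f2 : q ^ 2 * (q ^ 2) ^ (m + 2 * k + 1) = q ^ 4 * (q ^ (2 * k)) ^ 2 * q ^ (2 * m) := by ring
  have f3 : q ^ 2 * (q ^ 2) ^ (m + 2 * k + 1 + 1) = q ^ 6 * (q ^ (2 * k)) ^ 2 * q ^ (2 * m) := by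
    ring
  have f4 : -q ^ 2 * (q ^ 2) ^ (k + m) = -(q ^ 2 * q ^ (2 * k) * q ^ (2 * m)) := by ring
  have f5 : q ^ (2 * k + 2) = q ^ 2 * q ^ (2 * k) := by ring
  have f6 : q ^ (2 * (m + 1)) = q ^ 2 * q ^ (2 * m) := by ring
  have f7 : q ^ (2 * m * (k + 1) + m * (m + 1)) =
      q ^ (2 * m * k + m * (m + 1)) * q ^ (2 * m) := by ring
  have f8 : q ^ (2 * (m + 1) * k + (m + 1) * (m + 1 + 1)) =
      q ^ (2 * m * k + m * (m + 1)) * (q ^ 2 * q ^ (2 * k) * q ^ (2 * m)) := by ring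
  have g1 : q ^ (2 * m + 1 + 1) = q ^ 2 * q ^ (2 * m) := by ring
  have g2 : q ^ (2 * m + 4 * k + 3 + 1) = q ^ 4 * (q ^ (2 * k)) ^ 2 * q ^ (2 * m) := by ring
  have g3 : q ^ (2 * m + 4 * k + 5 + 1) = q ^ 6 * (q ^ (2 * k)) ^ 2 * q ^ (2 * m) := by ring
  have g4 : q ^ (2 * m + 4 * k + 4) = q ^ 4 * (q ^ (2 * k)) ^ 2 * q ^ (2 * m) := by ring
  have g5 : q ^ (2 * (m + 1) + 4 * k + 4) = q ^ 6 * (q ^ (2 * k)) ^ 2 * q ^ (2 * m) := by ring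
  rw [g1] at h1
  rw [g2] at h2
  rw [g3] at h3
  rw [f1, f2, f3, f4, f5, f6, f7, f8, g4, g5]
  generalize q ^ (2 * k) = y at *
  generalize q ^ (2 * m) = z at *
  generalize q ^ (2 * m * k + m * (m + 1)) = e at *
  field_simp
  ring

lemma norm_neg_sq_lt_one {q : ℂ} (hq : ‖q‖ < 1) : ‖-q ^ 2‖ < 1 := by
  rw [norm_neg]; exact norm_sq_lt_one hq

lemma norm_pow_le_pow {q : ℂ} (hq : ‖q‖ < 1) {m n : ℕ} (h : m ≤ n) : ‖q ^ n‖ ≤ ‖q‖ ^ m := by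
  rw [norm_pow]; exact pow_le_pow_of_le_one (norm_nonneg _) hq.le h

lemma exists_norm_gaussTerm_le {q : ℂ} (hq : ‖q‖ < 1) :
    ∃ C : ℝ, 0 < C ∧ ∀ k m, ‖gaussTerm q k m‖ ≤ C * ‖q‖ ^ m := by
  have hp := norm_sq_lt_one hq
  obtain ⟨A, hA, hA'⟩ := exists_norm_qpn_le hp hp
  obtain ⟨B, hB, hB'⟩ := exists_norm_qpn_le (norm_neg_sq_lt_one hq) hp
  refine ⟨B * (A * A), by positivity, fun k m => ?_⟩
  have h := norm_pow_le_pow hq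
    (show m ≤ 2 * m * k + m * (m + 1) by nlinarith [Nat.zero_le (m * k)])
  rw [gaussTerm, div_eq_mul_inv, mul_inv, norm_mul, norm_mul, norm_mul, mul_right_comm]
  have := (hB' (k + m)).1
  have := (hA' m).2
  have := (hA' (m + 2 * k + 1)).2
  gcongr

lemma summable_gaussTerm {q : ℂ} (hq : ‖q‖ < 1) (k : ℕ) : Summable (gaussTerm q k) := by
  obtain ⟨C, -, hC⟩ := exists_norm_gaussTerm_le hq
  exact .of_norm_bounded ((summable_geometric_of_lt_one (norm_nonneg _) hq).mul_left C) (hC k)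

lemma tendsto_gaussCert {q : ℂ} (hq : ‖q‖ < 1) (k : ℕ) :
    Tendsto (gaussCert q k) atTop (𝓝 0) := by
  have h0 : Tendsto (fun m : ℕ => q ^ (2 * m)) atTop (𝓝 0) := by
    simpa only [pow_mul] using tendsto_pow_atTop_nhds_zero_of_norm_lt_one (norm_sq_lt_one hq)
  have h1 : Tendsto (fun m : ℕ => q ^ (2 * m + 4 * k + 4)) atTop (𝓝 0) := by
    simpa only [pow_add, zero_mul] using (h0.mul_const (q ^ (4 * k))).mul_const (q ^ 4)
  have h := ((((h0.const_mul (q ^ (2 * k + 2) * (1 - q ^ (2 * k + 2)))).const_add 1).mul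
    (h0.const_sub 1)).div (h1.const_sub 1) (by simp)).mul
      (summable_gaussTerm hq k).tendsto_atTop_zero
  simp only [mul_zero] at h
  exact h

lemma tsum_gaussTerm_succ {q : ℂ} (hq : ‖q‖ < 1) (k : ℕ) :
    ∑' m, gaussTerm q (k + 1) m = ∑' m, gaussTerm q k m := by
  have hs := (summable_gaussTerm hq (k + 1)).sub (summable_gaussTerm hq k)
  have h := hs.hasSum.tendsto_sum_nat
  simp only [gaussTerm_succ_sub hq k, sum_range_sub] at h
  have h' := tendsto_nhds_unique h ((tendsto_gaussCert hq k).sub_const (gaussCert q k 0))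
  simp only [← gaussTerm_succ_sub hq k] at h'
  rw [(summable_gaussTerm hq (k + 1)).tsum_sub (summable_gaussTerm hq k)] at h'
  have h0 : gaussCert q k 0 = 0 := by simp [gaussCert]
  rw [h0, sub_zero] at h'
  exact sub_eq_zero.mp h'

lemma tendsto_gaussTerm {q : ℂ} (hq : ‖q‖ < 1) (m : ℕ) :
    Tendsto (fun k => gaussTerm q k m) atTop
      (𝓝 (if m = 0 then qpinf (-q ^ 2) (q ^ 2) / qpinf (q ^ 2) (q ^ 2) else 0)) := by
  have hp := norm_sq_lt_one hq
  have hn : Tendsto (fun k => qpn (-q ^ 2) (q ^ 2) (k + m)) atTop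
      (𝓝 (qpinf (-q ^ 2) (q ^ 2))) :=
    (tendsto_qpn _ hp).comp (tendsto_add_atTop_nat m)
  have hd : Tendsto (fun k => qpn (q ^ 2) (q ^ 2) (m + 2 * k + 1)) atTop
      (𝓝 (qpinf (q ^ 2) (q ^ 2))) :=
    (tendsto_qpn _ hp).comp (tendsto_atTop_mono (fun k => by simp; omega) tendsto_id)
  have he : Tendsto (fun k => q ^ (2 * m * k + m * (m + 1))) atTop
      (𝓝 (if m = 0 then 1 else 0)) := by
    split_ifs with h
    · simp [h]
    · have h1 : ‖q ^ (2 * m)‖ < 1 := by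
        rw [norm_pow]; exact pow_lt_one₀ (norm_nonneg _) hq (by omega)
      simpa only [pow_add, pow_mul, zero_mul] using
        (tendsto_pow_atTop_nhds_zero_of_norm_lt_one h1).mul_const (q ^ (m * (m + 1)))
  have h := (hn.mul he).div (hd.const_mul (qpn (q ^ 2) (q ^ 2) m))
    (mul_ne_zero (qpn_ne_zero hp hp m) (qpinf_ne_zero hp hp))
  refine (h.congr fun k => rfl).trans (le_of_eq ?_)
  split_ifs with hm
  · simp [hm, qpn_zero]
  · simp

lemma tsum_gaussTerm {q : ℂ} (hq : ‖q‖ < 1) (k : ℕ) :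
    ∑' m, gaussTerm q k m = qpinf (-q ^ 2) (q ^ 2) / qpinf (q ^ 2) (q ^ 2) := by
  have hconst : ∀ k, ∑' m, gaussTerm q k m = ∑' m, gaussTerm q 0 m := fun k => by
    induction k with
    | zero => rfl
    | succ k ih => rw [tsum_gaussTerm_succ hq, ih]
  obtain ⟨C, -, hC⟩ := exists_norm_gaussTerm_le hq
  have h := tendsto_tsum_of_dominated_convergence
    ((summable_geometric_of_lt_one (norm_nonneg _) hq).mul_left C)
    (tendsto_gaussTerm hq) (Eventually.of_forall hC)
  simp only [hconst, tsum_ite_eq] at h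
  rw [hconst k]
  exact tendsto_nhds_unique tendsto_const_nhds h

/-- Summand of the series obtained from `B(q)` after `N` steps of Fine's iteration. -/
def fineTerm (q : ℂ) (N n : ℕ) : ℂ :=
  q ^ n * (q ^ 2) ^ (N * n) * qpn (-q) (q ^ 2) n / qpn q (q ^ 2) (N + n + 1)

lemma exists_norm_fineTerm_le {q : ℂ} (hq : ‖q‖ < 1) :
    ∃ C : ℝ, 0 < C ∧ ∀ N n, ‖fineTerm q N n‖ ≤ C * ‖q‖ ^ n := by
  have hp := norm_sq_lt_one hq
  obtain ⟨A, hA, hA'⟩ := exists_norm_qpn_le hq hp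
  obtain ⟨B, hB, hB'⟩ := exists_norm_qpn_le (a := -q) (by simpa using hq) hp
  refine ⟨B * A, by positivity, fun N n => ?_⟩
  have h : ‖q ^ n * (q ^ 2) ^ (N * n)‖ ≤ ‖q‖ ^ n := by
    rw [← pow_mul, ← pow_add]; exact norm_pow_le_pow hq (by omega)
  rw [fineTerm, div_eq_mul_inv, norm_mul, norm_mul, mul_assoc, mul_comm (B * A)]
  have := (hB' n).1
  have := (hA' (N + n + 1)).2
  gcongr

lemma summable_fineTerm {q : ℂ} (hq : ‖q‖ < 1) (N : ℕ) : Summable (fineTerm q N) := by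
  obtain ⟨C, -, hC⟩ := exists_norm_fineTerm_le hq
  exact .of_norm_bounded ((summable_geometric_of_lt_one (norm_nonneg _) hq).mul_left C) (hC N)

lemma fineTerm_succ {q : ℂ} (hq : ‖q‖ < 1) (N n : ℕ) :
    fineTerm q N (n + 1) = q * (q ^ 2) ^ N * fineTerm q N n +
      (q ^ 2) ^ (N + 1) * (1 + (q ^ 2) ^ (N + 1)) * fineTerm q (N + 1) n := by
  have hp := norm_sq_lt_one hq
  have e1 : N + (n + 1) + 1 = N + n + 1 + 1 := by omega
  have e2 : N + 1 + n + 1 = N + n + 1 + 1 := by omega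
  simp only [fineTerm, e1, e2]
  have hD := qpn_ne_zero hq hp (N + n + 1)
  have h1 := one_sub_mul_pow_ne_zero hq hp (N + n + 1)
  rw [qpn_succ _ _ n, qpn_succ _ _ (N + n + 1)]
  field_simp
  ring

lemma tsum_fineTerm {q : ℂ} (hq : ‖q‖ < 1) (N : ℕ) :
    (1 - q * (q ^ 2) ^ N) * ∑' n, fineTerm q N n = (qpn q (q ^ 2) (N + 1))⁻¹ +
      (q ^ 2) ^ (N + 1) * (1 + (q ^ 2) ^ (N + 1)) * ∑' n, fineTerm q (N + 1) n := by
  have h := (summable_fineTerm hq N).tsum_eq_zero_add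
  have h0 : fineTerm q N 0 = (qpn q (q ^ 2) (N + 1))⁻¹ := by simp [fineTerm, qpn_zero]
  simp only [fineTerm_succ hq N, h0] at h
  rw [((summable_fineTerm hq N).mul_left _).tsum_add ((summable_fineTerm hq (N + 1)).mul_left _),
    tsum_mul_left, tsum_mul_left] at h
  linear_combination h

/-- Summand of the Eulerian form `B(q) = ∑ q^{n(n+1)} (-q²;q²)_n / (q;q²)_{n+1}²`. -/
def eulerTerm (q : ℂ) (n : ℕ) : ℂ :=
  q ^ (n * (n + 1)) * qpn (-q ^ 2) (q ^ 2) n * (qpn q (q ^ 2) (n + 1) ^ 2)⁻¹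

lemma tsum_fineTerm_zero_eq {q : ℂ} (hq : ‖q‖ < 1) (N : ℕ) :
    ∑' n, fineTerm q 0 n = ∑ n ∈ range N, eulerTerm q n +
      q ^ (N * (N + 1)) * qpn (-q ^ 2) (q ^ 2) N / qpn q (q ^ 2) N * ∑' n, fineTerm q N n := by
  have hp := norm_sq_lt_one hq
  induction N with
  | zero => simp [qpn_zero]
  | succ N ih =>
    rw [ih, sum_range_succ, add_assoc, add_right_inj]
    have h := tsum_fineTerm hq N
    have hD := qpn_ne_zero hq hp N
    have h1 := one_sub_mul_pow_ne_zero hq hp N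
    rw [mul_comm, ← eq_div_iff h1] at h
    rw [h, eulerTerm, qpn_succ q, qpn_succ (-q ^ 2)]
    generalize ∑' n, fineTerm q (N + 1) n = E at *
    have f1 : q ^ ((N + 1) * (N + 1 + 1)) = q ^ (N * (N + 1)) * (q ^ 2) ^ (N + 1) := by ring
    rw [f1]
    field_simp
    ring

lemma tendsto_sum_eulerTerm {q : ℂ} (hq : ‖q‖ < 1) :
    Tendsto (fun N => ∑ n ∈ range N, eulerTerm q n) atTop (𝓝 (∑' n, fineTerm q 0 n)) := by
  have hp := norm_sq_lt_one hq
  obtain ⟨A, hA, hA'⟩ := exists_norm_qpn_le hq hp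
  obtain ⟨B, hB, hB'⟩ := exists_norm_qpn_le (norm_neg_sq_lt_one hq) hp
  obtain ⟨C, hC, hC'⟩ := exists_norm_fineTerm_le hq
  have hg := summable_geometric_of_lt_one (norm_nonneg _) hq
  have hE : ∀ N, ‖∑' n, fineTerm q N n‖ ≤ C * ∑' n, ‖q‖ ^ n := fun N => by
    rw [← tsum_mul_left]
    exact tsum_of_norm_bounded (hg.mul_left C).hasSum (hC' N)
  have hz : Tendsto (fun N : ℕ => q ^ (N * (N + 1)) * qpn (-q ^ 2) (q ^ 2) N /
      qpn q (q ^ 2) N * ∑' n, fineTerm q N n) atTop (𝓝 0) := by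
    refine squeeze_zero_norm (a := fun N => ‖q‖ ^ N * (B * A * (C * ∑' n, ‖q‖ ^ n)))
      (fun N => ?_) ?_
    · have h := norm_pow_le_pow hq (show N ≤ N * (N + 1) by nlinarith)
      rw [div_eq_mul_inv, norm_mul, norm_mul, norm_mul, ← mul_assoc, ← mul_assoc (‖q‖ ^ N)]
      have := (hB' N).1
      have := (hA' N).2
      have := hE N
      gcongr
    · simpa using (tendsto_pow_atTop_nhds_zero_of_lt_one (norm_nonneg _) hq).mul_const
        (B * A * (C * ∑' n, ‖q‖ ^ n))
  have h := hz.const_sub (∑' n, fineTerm q 0 n)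
  rw [sub_zero] at h
  refine h.congr fun N => ?_
  rw [tsum_fineTerm_zero_eq hq N]
  ring

lemma norm_appellCoeff_le {q : ℂ} (hq : ‖q‖ < 1) (k : ℕ) :
    ‖appellCoeff q k‖ ≤ 2 / (1 - ‖q‖) := by
  have h0 : 0 < 1 - ‖q‖ := by linarith
  have h1 : ‖q ^ (2 * k + 1)‖ ≤ ‖q‖ := by
    simpa using norm_pow_le_pow hq (show 1 ≤ 2 * k + 1 by omega)
  have h2 : ‖1 + q ^ (2 * k + 1)‖ ≤ 2 := by
    have := norm_add_le (1 : ℂ) (q ^ (2 * k + 1))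
    rw [norm_one] at this
    linarith
  have h3 : 1 - ‖q‖ ≤ ‖1 - q ^ (2 * k + 1)‖ := by
    have := norm_sub_norm_le (1 : ℂ) (q ^ (2 * k + 1))
    rw [norm_one] at this
    linarith
  have h4 : ‖q ^ (k * (k + 1))‖ ≤ 1 := by
    simpa using norm_pow_le_pow hq (Nat.zero_le (k * (k + 1)))
  have h5 : ‖(1 + q ^ (2 * k + 1)) / (1 - q ^ (2 * k + 1))‖ ≤ 2 / (1 - ‖q‖) := by
    rw [norm_div]; gcongr
  rw [appellCoeff, norm_mul, norm_mul, norm_pow, norm_neg, norm_one, one_pow, one_mul]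
  calc _ ≤ 1 * (2 / (1 - ‖q‖)) := by gcongr
    _ = _ := one_mul _

/-- Summand of the Appell-type series for `B(q)`. -/
def appellTerm (q : ℂ) (k : ℕ) : ℂ := appellCoeff q k * q ^ (k * (k + 1))

lemma norm_appellTerm_le {q : ℂ} (hq : ‖q‖ < 1) (k : ℕ) :
    ‖appellTerm q k‖ ≤ 2 / (1 - ‖q‖) * ‖q‖ ^ k := by
  have h0 : 0 < 1 - ‖q‖ := by linarith
  have h := norm_pow_le_pow hq (show k ≤ k * (k + 1) by nlinarith)
  have := norm_appellCoeff_le hq k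
  rw [appellTerm, norm_mul]
  gcongr

lemma summable_norm_appellTerm {q : ℂ} (hq : ‖q‖ < 1) : Summable fun k => ‖appellTerm q k‖ :=
  .of_nonneg_of_le (fun _ => norm_nonneg _) (norm_appellTerm_le hq)
    ((summable_geometric_of_lt_one (norm_nonneg _) hq).mul_left _)

lemma eulerTerm_eq_sum_antidiagonal {q : ℂ} (hq : ‖q‖ < 1) (n : ℕ) :
    eulerTerm q n = ∑ x ∈ antidiagonal n, appellTerm q x.1 * gaussTerm q x.1 x.2 := by
  rw [eulerTerm, inv_qpn_sq_eq_sum hq, mul_sum,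
    Nat.sum_antidiagonal_eq_sum_range_succ fun k m => appellTerm q k * gaussTerm q k m]
  refine sum_congr rfl fun k hk => ?_
  obtain ⟨i, rfl⟩ := Nat.exists_eq_add_of_le (Nat.lt_succ_iff.mp (mem_range.mp hk))
  have e1 : k + i - k = i := by omega
  have e2 : i + 2 * k + 1 = k + i + k + 1 := by omega
  have f1 : q ^ ((k + i) * (k + i + 1)) = q ^ (k * (k + 1)) * q ^ (2 * i * k + i * (i + 1)) := by
    ring
  rw [appellTerm, gaussTerm, e1, e2, f1]
  ring

lemma tsum_fineTerm_zero {q : ℂ} (hq : ‖q‖ < 1) :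
    ∑' n, fineTerm q 0 n =
      qpinf (-q ^ 2) (q ^ 2) / qpinf (q ^ 2) (q ^ 2) * ∑' k, appellTerm q k := by
  obtain ⟨C, hC, hC'⟩ := exists_norm_gaussTerm_le hq
  have hgeo := summable_geometric_of_lt_one (norm_nonneg _) hq
  have h0 : 0 < 1 - ‖q‖ := by linarith
  have hs : Summable fun x : ℕ × ℕ => appellTerm q x.1 * gaussTerm q x.1 x.2 := by
    refine .of_norm_bounded (((hgeo.mul_left (2 / (1 - ‖q‖))).mul_of_nonneg (hgeo.mul_left C)
      (fun _ => by positivity) (fun _ => by positivity))) fun x => ?_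
    rw [norm_mul]
    have := norm_appellTerm_le hq x.1
    have := hC' x.1 x.2
    gcongr
  have hE : HasSum (eulerTerm q) (∑' x : ℕ × ℕ, appellTerm q x.1 * gaussTerm q x.1 x.2) := by
    have h := (HasAntidiagonal.sigmaAntidiagonalEquivProd (A := ℕ)).hasSum_iff.mpr hs.hasSum
    refine h.sigma fun n => ?_
    rw [eulerTerm_eq_sum_antidiagonal hq]
    exact (antidiagonal n).hasSum fun x : ℕ × ℕ => appellTerm q x.1 * gaussTerm q x.1 x.2
  rw [tendsto_nhds_unique (tendsto_sum_eulerTerm hq) hE.tendsto_sum_nat, hs.tsum_prod,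
    ← tsum_mul_left]
  refine tsum_congr fun k => ?_
  simp only
  rw [tsum_mul_left, tsum_gaussTerm hq, mul_comm]

lemma qpinf_even_mul_odd (a : ℂ) {p : ℂ} (hp : ‖p‖ < 1) :
    qpinf a (p ^ 2) * qpinf (a * p) (p ^ 2) = qpinf a p := by
  have he (j : ℕ) : 1 - a * (p ^ 2) ^ j = 1 - a * p ^ (2 * j) := by ring
  have ho (j : ℕ) : 1 - a * p * (p ^ 2) ^ j = 1 - a * p ^ (2 * j + 1) := by ring
  have hp2 := norm_sq_lt_one hp
  simp only [qpinf, he, ho]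
  exact tprod_even_mul_odd (f := fun j : ℕ => 1 - a * p ^ j)
    (by simpa only [he] using multipliable_one_sub_mul_pow a hp2)
    (by simpa only [ho] using multipliable_one_sub_mul_pow (a * p) hp2)

lemma qpinf_mul_neg (a : ℂ) {p : ℂ} (hp : ‖p‖ < 1) :
    qpinf a p * qpinf (-a) p = qpinf (a ^ 2) (p ^ 2) := by
  rw [qpinf, qpinf, qpinf, ← (multipliable_one_sub_mul_pow a hp).tprod_mul
    (multipliable_one_sub_mul_pow (-a) hp)]
  refine tprod_congr fun j => ?_
  ring

lemma qpinf_eq_mul (a : ℂ) {p : ℂ} (hp : ‖p‖ < 1) :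
    qpinf a p = (1 - a) * qpinf (a * p) p := by
  refine tendsto_nhds_unique ((tendsto_add_atTop_iff_nat 1).mpr (tendsto_qpn a hp)) ?_
  refine ((tendsto_qpn (a * p) hp).const_mul (1 - a)).congr fun n => ?_
  rw [qpn, qpn, prod_range_succ']
  simp only [pow_succ, pow_zero, mul_one]
  rw [mul_comm]
  congr 1
  refine prod_congr rfl fun j _ => ?_
  ring

lemma thetaP_eq {q : ℂ} (hq0 : q ≠ 0) (hq : ‖q‖ < 1) :
    thetaP (q ^ 4) (-q ^ 6) =
      -(qpinf (q ^ 2) (q ^ 2) / qpinf (-q ^ 2) (q ^ 2)) / q ^ 2 := by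
  have hp := norm_sq_lt_one hq
  have hp2 := norm_sq_lt_one hp
  have hM := qpinf_ne_zero (norm_neg_sq_lt_one hq) hp
  have hP := qpinf_ne_zero hp hp
  have e4 : (q ^ 2) ^ 2 = q ^ 4 := by ring
  have h1 := qpinf_even_mul_odd (q ^ 2) hp
  have h2 := qpinf_mul_neg (q ^ 2) hp
  have h3 := qpinf_eq_mul (q ^ 2) hp2
  have h4 := qpinf_eq_mul (-q ^ 4 / -q ^ 6) hp2
  have e5 : q ^ 2 * q ^ 2 = q ^ 4 := by ring
  have e6 : q ^ 2 * q ^ 4 = q ^ 6 := by ring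
  have e7 : -q ^ 4 / -q ^ 6 * q ^ 4 = q ^ 2 := by field_simp
  rw [e4] at h1 h2 h3 h4
  rw [e5] at h1
  rw [e6] at h3
  rw [e7] at h4
  rw [thetaP, neg_neg, h4]
  rw [← h2] at h1 ⊢
  have h5 : qpinf (q ^ 2) (q ^ 4) * qpinf (-q ^ 2) (q ^ 2) = 1 := by
    apply mul_left_cancel₀ hP
    linear_combination h1
  generalize qpinf (q ^ 2) (q ^ 2) = P at *
  generalize qpinf (-q ^ 2) (q ^ 2) = M at *
  generalize qpinf (q ^ 2) (q ^ 4) = R at *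
  generalize qpinf (q ^ 6) (q ^ 4) = Z at *
  have e8 : 1 - -q ^ 4 / -q ^ 6 = -(1 - q ^ 2) / q ^ 2 := by field_simp; ring
  rw [e8]
  field_simp
  linear_combination M ^ 2 * R * h3 - (R * M + 1) * h5

lemma bilateral_natCast {q : ℂ} (hq0 : q ≠ 0) (n : ℕ) :
    (1 + q ^ (4 * (n : ℤ) + 3)) / (1 - q ^ (4 * (n : ℤ) + 3)) *
      q ^ (8 * (n : ℤ) ^ 2 + 12 * n + 2) = -appellTerm q (2 * n + 1) / q ^ 2 := by
  have e1 : q ^ (4 * (n : ℤ) + 3) = q ^ (2 * (2 * n + 1) + 1) := by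
    rw [← zpow_natCast]; congr 1; push_cast; ring
  have e2 : q ^ (8 * (n : ℤ) ^ 2 + 12 * n + 2) = q ^ (8 * n ^ 2 + 12 * n + 2) := by
    rw [← zpow_natCast]; congr 1
  rw [e1, e2, appellTerm, appellCoeff, pow_succ (-1 : ℂ), pow_mul (-1 : ℂ)]
  field_simp
  ring

lemma bilateral_neg {q : ℂ} (hq0 : q ≠ 0) (hq : ‖q‖ < 1) (n : ℕ) :
    (1 + q ^ (4 * (-((n : ℤ) + 1)) + 3)) / (1 - q ^ (4 * (-((n : ℤ) + 1)) + 3)) *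
      q ^ (8 * (-((n : ℤ) + 1)) ^ 2 + 12 * (-((n : ℤ) + 1)) + 2) =
        -appellTerm q (2 * n) / q ^ 2 := by
  have e1 : q ^ (4 * (-((n : ℤ) + 1)) + 3) = (q ^ (2 * (2 * n) + 1))⁻¹ := by
    rw [← zpow_natCast, ← zpow_neg]; congr 1; push_cast; ring
  have e2 : q ^ (8 * (-((n : ℤ) + 1)) ^ 2 + 12 * (-((n : ℤ) + 1)) + 2) =
      q ^ (8 * n ^ 2 + 4 * n) / q ^ 2 := by
    rw [← zpow_natCast, ← zpow_natCast, ← zpow_sub₀ hq0]; congr 1; push_cast; ring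
  have h1 := one_sub_pow_succ_ne_zero hq (2 * (2 * n))
  have h2 := pow_ne_zero (2 * (2 * n) + 1) hq0
  have e3 : q ^ (2 * n * (2 * n + 1)) * q ^ (2 * n * (2 * n + 1)) = q ^ (8 * n ^ 2 + 4 * n) := by
    ring
  have e4 : (1 + (q ^ (2 * (2 * n) + 1))⁻¹) / (1 - (q ^ (2 * (2 * n) + 1))⁻¹) =
      -((1 + q ^ (2 * (2 * n) + 1)) / (1 - q ^ (2 * (2 * n) + 1))) := by
    generalize q ^ (2 * (2 * n) + 1) = w at *
    have h3 : w - 1 ≠ 0 := by rw [← neg_sub]; exact neg_ne_zero.mpr h1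
    field_simp
    ring
  rw [e1, e2, e4, appellTerm, appellCoeff, pow_mul (-1 : ℂ), ← e3]
  simp only [even_two, Even.neg_pow, one_pow, one_mul]
  ring

theorem stmt19 (q : ℂ) (hq0 : 0 < ‖q‖) (hq1 : ‖q‖ < 1) :
    Summable (fun n : ℕ => ‖q ^ n * qpn (-q) (q ^ 2) n / qpn q (q ^ 2) (n + 1)‖) ∧
    Summable (fun n : ℤ =>
      ‖(1 + q ^ (4 * n + 3)) / (1 - q ^ (4 * n + 3)) * q ^ (8 * n ^ 2 + 12 * n + 2)‖) ∧
    (∑' n : ℕ, q ^ n * qpn (-q) (q ^ 2) n / qpn q (q ^ 2) (n + 1))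
      = 1 / thetaP (q ^ 4) (-q ^ 6) *
          ∑' n : ℤ,
            (1 + q ^ (4 * n + 3)) / (1 - q ^ (4 * n + 3)) * q ^ (8 * n ^ 2 + 12 * n + 2) := by
  have hq : q ≠ 0 := norm_pos_iff.mp hq0
  have hfine : ∀ n, q ^ n * qpn (-q) (q ^ 2) n / qpn q (q ^ 2) (n + 1) = fineTerm q 0 n := by
    intro n; simp [fineTerm]
  have hA := summable_norm_appellTerm hq1
  have hodd : Summable fun n : ℕ => ‖-appellTerm q (2 * n + 1) / q ^ 2‖ := by
    simp only [norm_div, norm_neg]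
    exact (hA.comp_injective (i := fun n : ℕ => 2 * n + 1)
      fun a b h => by simpa using h).div_const _
  have heven : Summable fun n : ℕ => ‖-appellTerm q (2 * n) / q ^ 2‖ := by
    simp only [norm_div, norm_neg]
    exact (hA.comp_injective (i := fun n : ℕ => 2 * n) fun a b h => by simpa using h).div_const _
  have hZ : Summable (fun n : ℤ =>
      ‖(1 + q ^ (4 * n + 3)) / (1 - q ^ (4 * n + 3)) * q ^ (8 * n ^ 2 + 12 * n + 2)‖) := by
    refine .of_nat_of_neg_add_one ?_ ?_
    · simpa only [bilateral_natCast hq] using hodd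
    · simpa only [bilateral_neg hq hq1] using heven
  refine ⟨?_, hZ, ?_⟩
  · simp only [hfine]
    exact (summable_fineTerm hq1 0).norm
  · have hsum : ∑' n : ℤ, (1 + q ^ (4 * n + 3)) / (1 - q ^ (4 * n + 3)) *
        q ^ (8 * n ^ 2 + 12 * n + 2) = -(∑' k, appellTerm q k) / q ^ 2 := by
      rw [tsum_of_nat_of_neg_add_one
        (by simpa only [bilateral_natCast hq] using hodd.of_norm)
        (by simpa only [bilateral_neg hq hq1] using heven.of_norm)]
      simp only [bilateral_natCast hq, bilateral_neg hq hq1]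
      rw [add_comm, tsum_even_add_odd (f := fun k => -appellTerm q k / q ^ 2)
        heven.of_norm hodd.of_norm, tsum_div_const, tsum_neg]
    simp only [hfine]
    have hp := norm_sq_lt_one hq1
    have hM := qpinf_ne_zero (norm_neg_sq_lt_one hq1) hp
    have hP := qpinf_ne_zero hp hp
    rw [hsum, tsum_fineTerm_zero hq1, thetaP_eq hq hq1]
    field_simp
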